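/- arXiv:2407.10314 — 2 statements merged into one kernel-verified Lean document; each statement's English description precedes it below -/
import Mathlib

section
/- Let n ≥ 3 and let B be a 1-symmetric convex body in ℝⁿ with each standard basis vector e_i on its boundary, and suppose B is not the cube [−1,1]ⁿ, equivalently the point (1,1,…,1) does not belong to B. Then B can be illuminated by a set of directions of cardinality 2ⁿ − 2; hence the illumination number of B is at most 2ⁿ − 2. -/
/-- If no point `x + ε • d` with `ε > 0` lies in the interior of a convex set `B`, then some
nonzero functional attains its maximum over `B` at `x` and is nonnegative at `d`. -/
lemma exists_support_of_not_illuminated {n : ℕ} {B : Set (Fin n → ℝ)}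
    (hconv : Convex ℝ B) (hint : (interior B).Nonempty)
    {x d : Fin n → ℝ} (hx : x ∈ B) (h : ∀ ε : ℝ, 0 < ε → x + ε • d ∉ interior B) :
    ∃ g : Fin n → ℝ, g ≠ 0 ∧ (∀ y ∈ B, ∑ k, g k * y k ≤ ∑ k, g k * x k) ∧
      0 ≤ ∑ k, g k * d k := by
  have hray : Convex ℝ ((fun ε : ℝ => x + ε • d) '' Set.Ioi 0) := by
    have := ((convex_Ioi (0 : ℝ)).linear_image (LinearMap.toSpanSingleton ℝ _ d)).translate x
    simpa [Set.image_image] using this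
  have hdisj : Disjoint (interior B) ((fun ε : ℝ => x + ε • d) '' Set.Ioi 0) := by
    rw [Set.disjoint_right]
    rintro _ ⟨ε, hε, rfl⟩
    exact h ε hε
  obtain ⟨f, u, hf, hu⟩ :=
    geometric_hahn_banach_open hconv.interior isOpen_interior hray hdisj
  have hu' : ∀ ε : ℝ, 0 < ε → u ≤ f x + ε * f d := fun ε hε => by
    simpa using hu _ ⟨ε, hε, rfl⟩
  have hfB : ∀ y ∈ B, f y ≤ u := by
    intro y hy
    have hy' : y ∈ closure (interior B) := by
      rw [hconv.closure_interior_eq_closure_of_nonempty_interior hint]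
      exact subset_closure hy
    exact closure_minimal (t := {z | f z ≤ u}) (fun z hz => (hf z hz).le)
      (isClosed_le f.continuous continuous_const) hy'
  have hux : u ≤ f x := by
    refine le_of_forall_pos_le_add fun δ hδ => ?_
    have hpos : 0 < |f d| + 1 := by positivity
    have h1 := hu' (δ / (|f d| + 1)) (by positivity)
    have h2 : δ / (|f d| + 1) * f d ≤ δ := by
      rw [div_mul_eq_mul_div, div_le_iff₀ hpos]
      nlinarith [le_abs_self (f d)]
    linarith
  have hfd : 0 ≤ f d := by
    have h1 := hu' 1 one_pos
    have h2 := hfB x hx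
    linarith
  have hrep : ∀ v : Fin n → ℝ, f v = ∑ k, f (fun j => if k = j then 1 else 0) * v k := by
    intro v
    have := LinearMap.pi_apply_eq_sum_univ (f : (Fin n → ℝ) →ₗ[ℝ] ℝ) v
    simpa [mul_comm] using this
  refine ⟨fun k => f (fun j => if k = j then 1 else 0), ?_, ?_, ?_⟩
  · intro h0
    have hz : ∀ v, f v = 0 := fun v => by
      rw [hrep v]
      exact Finset.sum_eq_zero fun k _ => by
        have := congrFun h0 k
        simp only [Pi.zero_apply] at this
        rw [this, zero_mul]
    obtain ⟨y, hy⟩ := hint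
    have h1 := hf y hy
    rw [hz] at h1 hux
    linarith
  · intro y hy
    rw [← hrep y, ← hrep x]
    exact (hfB y hy).trans hux
  · rw [← hrep d]
    exact hfd

/-- Maximality of `g` at a point of a 1-symmetric set yields a rearrangement inequality. -/
lemma sum_abs_mul_abs_perm_le {n : ℕ} {B : Set (Fin n → ℝ)}
    (hsym : ∀ x ∈ B, ∀ σ : Equiv.Perm (Fin n), ∀ ε : Fin n → ℝ,
      (∀ i, ε i = 1 ∨ ε i = -1) → (fun i => ε i * x (σ i)) ∈ B)
    {x g : Fin n → ℝ} (hx : x ∈ B) (hg : ∀ y ∈ B, ∑ k, g k * y k ≤ ∑ k, g k * x k)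
    (σ : Equiv.Perm (Fin n)) :
    ∑ k, |g k| * |x (σ k)| ≤ ∑ k, g k * x k := by
  refine le_trans (le_of_eq ?_) (hg _ (hsym x hx σ
    (fun k => if 0 ≤ g k * x (σ k) then 1 else -1) fun k => by split_ifs <;> simp))
  refine Finset.sum_congr rfl fun k _ => ?_
  rw [← abs_mul]
  split_ifs with hk
  · rw [abs_of_nonneg hk]; ring
  · rw [abs_of_neg (not_le.mp hk)]; ring

lemma mul_nonneg_of_support {n : ℕ} {B : Set (Fin n → ℝ)}
    (hsym : ∀ x ∈ B, ∀ σ : Equiv.Perm (Fin n), ∀ ε : Fin n → ℝ,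
      (∀ i, ε i = 1 ∨ ε i = -1) → (fun i => ε i * x (σ i)) ∈ B)
    {x g : Fin n → ℝ} (hx : x ∈ B) (hg : ∀ y ∈ B, ∑ k, g k * y k ≤ ∑ k, g k * x k)
    (i : Fin n) : 0 ≤ g i * x i := by
  have h1 := sum_abs_mul_abs_perm_le hsym hx hg 1
  simp only [Equiv.Perm.coe_one, id_eq, ← abs_mul] at h1
  by_contra! hi
  have h2 : ∑ k, g k * x k < ∑ k, |g k * x k| :=
    Finset.sum_lt_sum (fun k _ => le_abs_self _)
      ⟨i, Finset.mem_univ i, hi.trans_le (abs_nonneg _)⟩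
  linarith

lemma abs_le_abs_of_support {n : ℕ} {B : Set (Fin n → ℝ)}
    (hsym : ∀ x ∈ B, ∀ σ : Equiv.Perm (Fin n), ∀ ε : Fin n → ℝ,
      (∀ i, ε i = 1 ∨ ε i = -1) → (fun i => ε i * x (σ i)) ∈ B)
    {x g : Fin n → ℝ} (hx : x ∈ B) (hg : ∀ y ∈ B, ∑ k, g k * y k ≤ ∑ k, g k * x k)
    {i j : Fin n} (hij : |x j| < |x i|) : |g j| ≤ |g i| := by
  have hne : i ≠ j := by
    rintro rfl
    exact lt_irrefl _ hij
  have h1 := sum_abs_mul_abs_perm_le hsym hx hg (Equiv.swap i j)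
  have h2 : ∑ k, g k * x k ≤ ∑ k, |g k| * |x k| :=
    Finset.sum_le_sum fun k _ => by rw [← abs_mul]; exact le_abs_self _
  have h3 : ∑ k, |g k| * (|x k| - |x (Equiv.swap i j k)|) =
      |g i| * (|x i| - |x j|) + |g j| * (|x j| - |x i|) := by
    rw [Fintype.sum_eq_add i j hne]
    · simp
    · rintro k ⟨hki, hkj⟩
      rw [Equiv.swap_apply_of_ne_of_ne hki hkj]
      ring
  simp only [mul_sub, Finset.sum_sub_distrib] at h3
  by_contra! hlt
  nlinarith

/-- A direction opposite to `x` on all coordinates of maximal modulus, with one of these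
dominating the coordinates outside of this set, illuminates `x`. -/
lemma illuminates_of_dominant {n : ℕ} {B : Set (Fin n → ℝ)}
    (hconv : Convex ℝ B) (hint : (interior B).Nonempty)
    (hsym : ∀ x ∈ B, ∀ σ : Equiv.Perm (Fin n), ∀ ε : Fin n → ℝ,
      (∀ i, ε i = 1 ∨ ε i = -1) → (fun i => ε i * x (σ i)) ∈ B)
    {x d : Fin n → ℝ} (hx : x ∈ B) (M : Finset (Fin n))
    (hM : ∀ i ∈ M, ∀ j ∉ M, |x j| < |x i|) (hd : ∀ i ∈ M, d i * x i < 0)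
    {t : Fin n} (ht : t ∈ M) (hdom : ∑ j ∈ Mᶜ, |d j| < |d t|) :
    ∃ ε : ℝ, 0 < ε ∧ x + ε • d ∈ interior B := by
  by_contra! hcon
  obtain ⟨g, hg0, hg, hgd⟩ := exists_support_of_not_illuminated hconv hint hx hcon
  have hMterm : ∀ i ∈ M, g i * d i = -(|g i| * |d i|) := by
    intro i hi
    have h1 := mul_nonneg_of_support hsym hx hg i
    have h2 := hd i hi
    rw [← abs_mul, abs_of_nonpos, neg_neg]
    by_contra! h3
    have hxi : x i ≠ 0 := by
      rintro h0
      simp [h0] at h2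
    have : 0 < x i * x i := mul_self_pos.mpr hxi
    nlinarith [mul_pos h3 this]
  have hout : ∑ j ∈ Mᶜ, g j * d j ≤ |g t| * ∑ j ∈ Mᶜ, |d j| := by
    rw [Finset.mul_sum]
    refine Finset.sum_le_sum fun j hj => ?_
    have := abs_le_abs_of_support hsym hx hg (hM t ht j (Finset.mem_compl.mp hj))
    calc g j * d j ≤ |g j| * |d j| := by rw [← abs_mul]; exact le_abs_self _
      _ ≤ |g t| * |d j| := by gcongr
  have hin : ∑ i ∈ M, g i * d i = -∑ i ∈ M, |g i| * |d i| := by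
    rw [Finset.sum_congr rfl hMterm, Finset.sum_neg_distrib]
  have hsplit := Finset.sum_add_sum_compl M fun i => g i * d i
  have hsingle : ∀ i ∈ M, |g i| * |d i| ≤ ∑ i ∈ M, |g i| * |d i| := fun i hi =>
    Finset.single_le_sum (f := fun i => |g i| * |d i|) (fun _ _ => by positivity) hi
  have hgt : g t = 0 := by
    by_contra hne
    have : 0 < |g t| := abs_pos.mpr hne
    have := hsingle t ht
    nlinarith
  apply hg0
  ext i
  by_cases hi : i ∈ M
  · have h1 := hsingle i hi
    have h2 : 0 < |d i| := abs_pos.mpr fun h0 => by simpa [h0] using hd i hi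
    have h3 : ∑ i ∈ M, |g i| * |d i| ≤ 0 := by
      rw [hgt, abs_zero, zero_mul] at hout
      linarith
    have h4 : |g i| ≤ 0 := by
      by_contra! h5
      nlinarith [mul_pos h5 h2]
    exact abs_nonpos_iff.mp h4
  · have := abs_le_abs_of_support hsym hx hg (hM t ht i hi)
    rw [hgt, abs_zero] at this
    exact abs_nonpos_iff.mp this

/-- A diagonal point `x` of modulus at most `r < 1` is illuminated by any direction opposite to `x`
up to one small coordinate. -/
lemma illuminates_diagonal {n : ℕ} {B : Set (Fin n → ℝ)}
    (hconv : Convex ℝ B) (hint : (interior B).Nonempty)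
    (hsym : ∀ x ∈ B, ∀ σ : Equiv.Perm (Fin n), ∀ ε : Fin n → ℝ,
      (∀ i, ε i = 1 ∨ ε i = -1) → (fun i => ε i * x (σ i)) ∈ B)
    (hbasis : ∀ i : Fin n, (Pi.single i (1 : ℝ) : Fin n → ℝ) ∈ B)
    {x d : Fin n → ℝ} (hx : x ∈ B) {r : ℝ} (hr0 : 0 < r) (hxr : ∀ i, |x i| ≤ r)
    (b : Fin n) (hd : ∀ i ≠ b, d i * x i < 0) (hd1 : ∀ i ≠ b, 1 ≤ |d i|)
    (hdb : |d b| * r < 1 - r) :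
    ∃ ε : ℝ, 0 < ε ∧ x + ε • d ∈ interior B := by
  by_contra! hcon
  obtain ⟨g, hg0, hg, hgd⟩ := exists_support_of_not_illuminated hconv hint hx hcon
  have hterm : ∀ i ≠ b, g i * d i ≤ -|g i| := by
    intro i hi
    have h1 := mul_nonneg_of_support hsym hx hg i
    have h2 := hd i hi
    have h3 : g i * d i ≤ 0 := by
      by_contra! h3
      have hxi : x i ≠ 0 := by
        rintro h0
        simp [h0] at h2
      have : 0 < x i * x i := mul_self_pos.mpr hxi
      nlinarith [mul_pos h3 this]
    have h4 : g i * d i = -(|g i| * |d i|) := by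
      rw [← abs_mul, abs_of_nonpos h3, neg_neg]
    rw [h4]
    nlinarith [abs_nonneg (g i), hd1 i hi]
  have hgb : |g b| ≤ ∑ k, g k * x k := by
    have h1 := hg _ (hbasis b)
    have h2 := hg _ (hsym _ (hbasis b) 1 (fun _ => -1) fun _ => Or.inr rfl)
    simp [Pi.single_apply] at h1 h2
    exact abs_le'.mpr ⟨h1, h2⟩
  have hgx : ∑ k, g k * x k ≤ r * ∑ k, |g k| := by
    rw [Finset.mul_sum]
    refine Finset.sum_le_sum fun k _ => ?_
    calc g k * x k ≤ |g k| * |x k| := by rw [← abs_mul]; exact le_abs_self _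
      _ ≤ r * |g k| := by nlinarith [abs_nonneg (g k), hxr k]
  have hS := Finset.add_sum_erase Finset.univ (fun k => |g k|) (Finset.mem_univ b)
  have hD := Finset.add_sum_erase Finset.univ (fun k => g k * d k) (Finset.mem_univ b)
  have hle : ∑ k ∈ Finset.univ.erase b, g k * d k ≤ -∑ k ∈ Finset.univ.erase b, |g k| := by
    rw [← Finset.sum_neg_distrib]
    exact Finset.sum_le_sum fun k hk => hterm k (Finset.ne_of_mem_erase hk)
  have hbd : g b * d b ≤ |d b| * |g b| := by
    rw [mul_comm, ← abs_mul]
    exact le_abs_self _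
  set S := ∑ k ∈ Finset.univ.erase b, |g k|
  have h1 : S ≤ |d b| * |g b| := by linarith
  have h2 : (1 - r) * |g b| ≤ r * S := by
    rw [← hS] at hgx
    linarith
  have h3 : |g b| ≤ 0 := by
    by_contra! h4
    nlinarith
  have hgb0 : |g b| = 0 := le_antisymm h3 (abs_nonneg _)
  have hS0 : S ≤ 0 := by simpa [hgb0] using h1
  apply hg0
  ext i
  by_cases hi : i = b
  · rw [hi]
    exact abs_eq_zero.mp hgb0
  · have : |g i| ≤ S := Finset.single_le_sum (f := fun k => |g k|)
      (fun _ _ => abs_nonneg _) (Finset.mem_erase.mpr ⟨hi, Finset.mem_univ i⟩)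
    exact abs_nonpos_iff.mp (this.trans hS0)

open Fin.NatCast in
lemma Fin.exists_notMem_add_one_mem {m : ℕ} {M : Finset (Fin (m + 3))} (hM : M.Nonempty)
    (hM' : M ≠ Finset.univ) : ∃ b, b ∉ M ∧ b + 1 ∈ M := by
  by_contra! h
  obtain ⟨c, hc⟩ := hM
  obtain ⟨b, hb⟩ : ∃ b, b ∉ M := by
    by_contra! h'
    exact hM' (Finset.eq_univ_iff_forall.mpr h')
  have key : ∀ k : ℕ, b + (k : Fin (m + 3)) ∉ M := by
    intro k
    induction k with
    | zero => simpa using hb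
    | succ k ih =>
      have := h _ ih
      rwa [add_assoc, ← Nat.cast_succ] at this
  apply key (c - b).val
  rwa [Fin.cast_val_eq_self, add_sub_cancel]

/-- Each vertex `A` of the discrete cube may be assigned a coordinate direction so that every proper
face (the sets with trace `P` on `M`) is left at some vertex other than `∅` and `univ`. -/
lemma exists_exit_direction (m : ℕ) :
    ∃ τ : Finset (Fin (m + 3)) → Fin (m + 3),
      (∀ a, τ {a} ≠ a) ∧ (∀ a, τ {a}ᶜ ≠ a) ∧
      ∀ M P : Finset (Fin (m + 3)), M.Nonempty → P ⊆ M →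
        (M = Finset.univ → P.Nonempty ∧ P ≠ Finset.univ) →
        ∃ A : Finset (Fin (m + 3)), A.Nonempty ∧ A ≠ Finset.univ ∧
          (∀ i ∈ M, i ∈ A ↔ i ∈ P) ∧ τ A ∈ M := by
  have h1 : ∀ a : Fin (m + 3), a + 1 ≠ a := by
    intro a h
    simp at h
  have h2 : ∀ a : Fin (m + 3), a + 1 + 1 ≠ a := by
    intro a h
    rw [add_assoc, add_eq_left] at h
    have := congrArg Fin.val h
    rw [Fin.val_add] at this
    simp [Nat.mod_eq_of_lt (show 2 < m + 3 by omega)] at this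
  have hex : ∀ A : Finset (Fin (m + 3)), ∃ t, (∀ a, A = {a} → t = a + 1) ∧
      (∀ a, A = {a, a + 1} → t = a) ∧ ((∀ a, A ≠ {a}) → A.Nonempty → t ∈ A) := by
    intro A
    by_cases hA1 : ∃ a, A = {a}
    · obtain ⟨a, rfl⟩ := hA1
      refine ⟨a + 1, fun b hb => by rw [Finset.singleton_inj.mp hb], fun b hb => ?_,
        fun h => absurd rfl (h a)⟩
      have hb1 : b ∈ ({a} : Finset (Fin (m + 3))) := by rw [hb]; simp
      have hb2 : b + 1 ∈ ({a} : Finset (Fin (m + 3))) := by rw [hb]; simp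
      rw [Finset.mem_singleton] at hb1 hb2
      exact absurd (hb2.trans hb1.symm) (h1 b)
    · push Not at hA1
      by_cases hA2 : ∃ a, A = {a, a + 1}
      · obtain ⟨a, rfl⟩ := hA2
        refine ⟨a, fun b hb => absurd hb (hA1 b), fun b hb => ?_, fun _ _ => by simp⟩
        have ha : a ∈ ({b, b + 1} : Finset (Fin (m + 3))) := by rw [← hb]; simp
        have ha1 : a + 1 ∈ ({b, b + 1} : Finset (Fin (m + 3))) := by rw [← hb]; simp
        simp only [Finset.mem_insert, Finset.mem_singleton] at ha ha1
        rcases ha with ha | ha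
        · exact ha
        · rcases ha1 with hb1 | hb1
          · rw [ha] at hb1
            exact absurd hb1 (h2 b)
          · exact add_right_cancel hb1
      · push Not at hA2
        by_cases hne : A.Nonempty
        · obtain ⟨t, ht⟩ := hne
          exact ⟨t, fun a ha => absurd ha (hA1 a), fun a ha => absurd ha (hA2 a), fun _ _ => ht⟩
        · exact ⟨0, fun a ha => absurd ha (hA1 a), fun a ha => absurd ha (hA2 a),
            fun _ h => absurd h hne⟩
  choose τ hτ1 hτ2 hτ3 using hex
  refine ⟨τ, fun a => by rw [hτ1 {a} a rfl]; exact h1 a, fun a => ?_, ?_⟩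
  · have hmem : τ {a}ᶜ ∈ ({a} : Finset (Fin (m + 3)))ᶜ := by
      refine hτ3 _ (fun b hb => ?_) ⟨a + 1, by simp⟩
      have := congrArg Finset.card hb
      rw [Finset.card_compl] at this
      simp at this
    simpa using hmem
  · intro M P hM hPM hcase
    have hP : P ≠ Finset.univ := by
      rintro rfl
      exact (hcase (Finset.univ_subset_iff.mp hPM)).2 rfl
    by_cases hP0 : P.Nonempty
    · by_cases hP1 : ∃ a, P = {a}
      · obtain ⟨a, rfl⟩ := hP1
        have ha : a ∈ M := hPM (by simp)
        by_cases ha1 : a + 1 ∈ M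
        · exact ⟨{a}, hP0, hP, fun _ _ => Iff.rfl, by rwa [hτ1 {a} a rfl]⟩
        · refine ⟨{a, a + 1}, by simp, fun h => ?_, fun i hi => ?_, ?_⟩
          · have : a + 1 + 1 ∈ ({a, a + 1} : Finset (Fin (m + 3))) := by rw [h]; simp
            simp only [Finset.mem_insert, Finset.mem_singleton] at this
            exact this.elim (h2 a) (h1 (a + 1))
          · have : i ≠ a + 1 := by
              rintro rfl
              exact ha1 hi
            simp [this]
          · rwa [hτ2 _ a rfl]
      · push Not at hP1
        exact ⟨P, hP0, hP, fun _ _ => Iff.rfl, hPM (hτ3 P hP1 hP0)⟩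
    · have hMu : M ≠ Finset.univ := fun h => hP0 (hcase h).1
      obtain ⟨b, hb, hb1⟩ := Fin.exists_notMem_add_one_mem hM hMu
      rw [Finset.not_nonempty_iff_eq_empty] at hP0
      subst hP0
      refine ⟨{b}, by simp, fun h => ?_, fun i hi => ?_, by rwa [hτ1 {b} b rfl]⟩
      · have : b + 1 ∈ ({b} : Finset (Fin (m + 3))) := by rw [h]; simp
        exact h1 b (Finset.mem_singleton.mp this)
      · have : i ≠ b := by
          rintro rfl
          exact hb hi
        simp [this]

/-- The direction positive exactly on `A`, large at the coordinate `t` and of modulus `η` at a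
coordinate in which `A` differs from both its neighbours `∅` or `univ`. -/
noncomputable def illuminatingDirection {n : ℕ} (η : ℝ) (t : Fin n) (A : Finset (Fin n)) :
    Fin n → ℝ := fun i =>
  (if i ∈ A then 1 else -1) * (if i = t then (n : ℝ) else if A = {i} ∨ A = {i}ᶜ then η else 1)

/-- Theorem E: for `n ≥ 3`, every `B ∈ 𝒮ⁿ` which is not the cube (equivalently,
`(1,…,1) ∉ B`) can be illuminated by a set of `2ⁿ - 2` directions, so `𝔍(B) ≤ 2ⁿ - 2`. -/
theorem stmt_14 {n : ℕ} (hn : 3 ≤ n) (B : Set (Fin n → ℝ))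
    (hB_conv : Convex ℝ B) (hB_comp : IsCompact B) (hB_int : (interior B).Nonempty)
    (hB_sym : ∀ x ∈ B, ∀ σ : Equiv.Perm (Fin n), ∀ ε : Fin n → ℝ,
      (∀ i, ε i = 1 ∨ ε i = -1) → (fun i => ε i * x (σ i)) ∈ B)
    (hB_norm : ∀ i : Fin n, (Pi.single i (1 : ℝ) : Fin n → ℝ) ∈ frontier B)
    (hnotcube : (fun _ : Fin n => (1 : ℝ)) ∉ B) :
    ∃ D : Finset (Fin n → ℝ), D.card = 2 ^ n - 2 ∧
      ∀ x ∈ frontier B, ∃ d ∈ D, ∃ ε : ℝ, 0 < ε ∧ x + ε • d ∈ interior B := by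
  obtain ⟨m, rfl⟩ : ∃ m, n = m + 3 := ⟨n - 3, by omega⟩
  have hclosed := hB_comp.isClosed
  have hfr : frontier B ⊆ B := hclosed.frontier_subset
  have hneg : ∀ y ∈ B, -y ∈ B := fun y hy => by
    convert hB_sym y hy 1 (fun _ => -1) fun _ => Or.inr rfl using 1
    ext i
    simp
  have h0 : (0 : Fin (m + 3) → ℝ) ∈ interior B := by
    obtain ⟨y, hy⟩ := hB_int
    have := hB_conv.combo_interior_self_mem_interior hy (hneg y (interior_subset hy))
      (a := 1 / 2) (b := 1 / 2) (by norm_num) (by norm_num) (by norm_num)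
    simpa using this
  obtain ⟨r, hr0, hr1, hr⟩ : ∃ r : ℝ, 0 < r ∧ r < 1 ∧ (fun _ : Fin (m + 3) => r) ∉ B := by
    have hopen : IsOpen {r : ℝ | (fun _ : Fin (m + 3) => r) ∉ B} :=
      hclosed.isOpen_compl.preimage (continuous_pi fun _ => continuous_id)
    obtain ⟨δ, hδ, hball⟩ := Metric.isOpen_iff.mp hopen 1 hnotcube
    have hmin : 0 < min (δ / 2) (1 / 2) := by positivity
    have hmin1 := min_le_left (δ / 2) (1 / 2)
    have hmin2 := min_le_right (δ / 2) (1 / 2)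
    refine ⟨1 - min (δ / 2) (1 / 2), by linarith, by linarith, hball ?_⟩
    rw [Metric.mem_ball, Real.dist_eq, abs_lt]
    constructor <;> linarith
  have hdiag : ∀ t : ℝ, (fun _ : Fin (m + 3) => t) ∈ B → t ≤ r := by
    intro t ht
    by_contra! hlt
    apply hr
    have h := hB_conv.smul_mem_of_zero_mem (interior_subset h0) ht
      (t := r / t) ⟨(div_pos hr0 (hr0.trans hlt)).le, (div_le_one (hr0.trans hlt)).mpr hlt.le⟩
    have hne : t ≠ 0 := by linarith
    convert h using 1
    ext i
    simp [hne]
  obtain ⟨τ, hτ1, hτ2, hτ⟩ := exists_exit_direction m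
  set η : ℝ := (1 - r) / 2 with hη
  have hη0 : 0 < η := by linarith
  have hη1 : η ≤ 1 := by linarith
  set dir : Finset (Fin (m + 3)) → Fin (m + 3) → ℝ := fun A => illuminatingDirection η (τ A) A
    with hdir
  have habs : ∀ A i, |dir A i| =
      if i = τ A then ((m + 3 : ℕ) : ℝ) else if A = {i} ∨ A = {i}ᶜ then η else 1 := by
    intro A i
    simp only [hdir, illuminatingDirection, abs_mul]
    have e1 : |(if i ∈ A then (1 : ℝ) else -1)| = 1 := by split_ifs <;> simp
    rw [e1, one_mul]
    apply abs_of_nonneg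
    split_ifs <;> positivity
  have hpos : ∀ A i, i ∈ A → 0 < dir A i := by
    intro A i hi
    simp only [hdir, illuminatingDirection, if_pos hi, one_mul]
    split_ifs <;> positivity
  have hnegd : ∀ A i, i ∉ A → dir A i < 0 := by
    intro A i hi
    simp only [hdir, illuminatingDirection, if_neg hi, neg_one_mul, neg_lt_zero]
    split_ifs <;> positivity
  set D₀ : Finset (Fin (m + 3) → ℝ) :=
    ((Finset.univ.erase ∅).erase Finset.univ).image dir with hD₀
  have hcard : D₀.card ≤ 2 ^ (m + 3) - 2 := by
    refine Finset.card_image_le.trans (le_of_eq ?_)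
    rw [Finset.card_erase_of_mem, Finset.card_erase_of_mem (Finset.mem_univ _), Finset.card_univ,
      Fintype.card_finset, Fintype.card_fin, Nat.sub_sub]
    exact Finset.mem_erase.mpr ⟨Finset.univ_nonempty.ne_empty, Finset.mem_univ _⟩
  have hmemD : ∀ A : Finset (Fin (m + 3)), A.Nonempty → A ≠ Finset.univ → dir A ∈ D₀ :=
    fun A hA hA' => Finset.mem_image_of_mem _ (by simp [hA', hA.ne_empty])
  obtain ⟨D, hDsub, hDcard⟩ := Infinite.exists_superset_card_eq D₀ _ hcard
  refine ⟨D, hDcard, fun x hxf => ?_⟩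
  suffices ∃ d ∈ D₀, ∃ ε : ℝ, 0 < ε ∧ x + ε • d ∈ interior B by
    obtain ⟨d, hd, h⟩ := this
    exact ⟨d, hDsub hd, h⟩
  have hx : x ∈ B := hfr hxf
  have hx0 : x ≠ 0 := by
    rintro rfl
    exact hxf.2 h0
  obtain ⟨i₀, hi₀⟩ := Finite.exists_max fun i => |x i|
  have hmax : 0 < |x i₀| := by
    obtain ⟨j, hj⟩ := Function.ne_iff.mp hx0
    exact (abs_pos.mpr hj).trans_le (hi₀ j)
  have hbasis : ∀ i, (Pi.single i (1 : ℝ) : Fin (m + 3) → ℝ) ∈ B := fun i => hfr (hB_norm i)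
  have hηr : η * r < 1 - r := by nlinarith
  by_cases hconst : ∃ t : ℝ, x = fun _ => t
  · obtain ⟨t, rfl⟩ := hconst
    have hxr : |t| ≤ r := abs_le'.mpr ⟨hdiag t hx, hdiag (-t) (hneg _ hx)⟩
    have ht0 : t ≠ 0 := abs_pos.mp hmax
    have key : ∀ A : Finset (Fin (m + 3)), A.Nonempty → A ≠ Finset.univ →
        (A = {0} ∨ A = {0}ᶜ) → (∀ i ≠ 0, dir A i * t < 0) → τ A ≠ 0 →
        ∃ d ∈ D₀, ∃ ε : ℝ, 0 < ε ∧ (fun _ => t) + ε • d ∈ interior B := by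
      intro A hA hA' hA0 hAt hτA
      refine ⟨dir A, hmemD A hA hA', illuminates_diagonal hB_conv hB_int hB_sym hbasis hx
        hr0 (fun _ => hxr) 0 hAt (fun i hi => ?_) ?_⟩
      · rw [habs]
        have : ¬(A = {i} ∨ A = {i}ᶜ) := by
          obtain ⟨k, hk0, hki⟩ : ∃ k : Fin (m + 3), k ≠ 0 ∧ k ≠ i := by
            by_cases h : i = 1
            · refine ⟨2, ?_, ?_⟩
              · simp [Fin.ext_iff, Nat.mod_eq_of_lt (show 2 < m + 3 by omega)]
              · simp [h, Fin.ext_iff, Nat.mod_eq_of_lt (show 2 < m + 3 by omega)]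
            · exact ⟨1, by simp, fun h' => h h'.symm⟩
          have hi' := Ne.symm hi
          rintro (rfl | rfl) <;> rcases hA0 with h | h
          · exact hi (Finset.singleton_inj.mp h)
          · have := Finset.ext_iff.mp h k
            simp [hk0, hki] at this
          · have := Finset.ext_iff.mp h k
            simp [hk0, hki] at this
          · have := Finset.ext_iff.mp h i
            simp [hi] at this
        rw [if_neg this]
        split_ifs
        · push_cast
          linarith [(Nat.cast_nonneg m : (0 : ℝ) ≤ m)]
        · exact le_rfl
      · rw [habs, if_neg (Ne.symm hτA), if_pos hA0]
        exact hηr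
    have hne1 : ({0} : Finset (Fin (m + 3))) ≠ Finset.univ := fun h => by
      have := Finset.ext_iff.mp h 1
      simp at this
    rcases lt_or_gt_of_ne ht0 with ht | ht
    · refine key {0}ᶜ ⟨1, by simp⟩ (fun h => ?_) (Or.inr rfl)
        (fun i hi => mul_neg_of_pos_of_neg (hpos _ i (by simpa using hi)) ht) (hτ2 0)
      have := Finset.ext_iff.mp h 0
      simp at this
    · exact key {0} (by simp) hne1 (Or.inl rfl)
        (fun i hi => mul_neg_of_neg_of_pos (hnegd _ i (by simpa using hi)) ht) (hτ1 0)
  · obtain ⟨A, hA, hA', hAM, hτA⟩ := hτ (Finset.univ.filter fun i => |x i| = |x i₀|)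
      (Finset.univ.filter fun i => |x i| = |x i₀| ∧ x i < 0) ⟨i₀, by simp⟩
      (fun i hi => by simp at hi ⊢; exact hi.1) (by
        intro hu
        have hall : ∀ i, |x i| = |x i₀| := fun i => by
          have : i ∈ Finset.univ.filter fun i => |x i| = |x i₀| := by rw [hu]; simp
          simpa using this
        constructor
        · by_contra hemp
          apply hconst
          refine ⟨|x i₀|, funext fun i => ?_⟩
          rw [← hall i, eq_comm, abs_eq_self]
          by_contra! hlt
          exact hemp ⟨i, by simp [hall i, hlt]⟩
        · intro hu'
          apply hconst
          refine ⟨-|x i₀|, funext fun i => ?_⟩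
          have : i ∈ Finset.univ.filter fun i => |x i| = |x i₀| ∧ x i < 0 := by rw [hu']; simp
          have hlt : x i < 0 := by simpa [hall i] using this
          rw [← hall i, abs_of_neg hlt, neg_neg])
    refine ⟨dir A, hmemD A hA hA', illuminates_of_dominant hB_conv hB_int hB_sym hx _
      (fun i hi j hj => ?_) (fun i hi => ?_) hτA ?_⟩
    · simp only [Finset.mem_filter, Finset.mem_univ, true_and] at hi hj
      rw [hi]
      exact lt_of_le_of_ne (hi₀ j) hj
    · have hiA := hAM i hi
      simp only [Finset.mem_filter, Finset.mem_univ, true_and] at hi hiA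
      have hxi : x i ≠ 0 := abs_pos.mp (hi ▸ hmax)
      rcases lt_or_gt_of_ne hxi with h | h
      · exact mul_neg_of_pos_of_neg (hpos A i (hiA.mpr ⟨hi, h⟩)) h
      · exact mul_neg_of_neg_of_pos
          (hnegd A i fun hi' => absurd (hiA.mp hi').2 (not_lt.mpr h.le)) h
    · set M := Finset.univ.filter fun i => |x i| = |x i₀|
      have hle : ∀ j ∈ Mᶜ, |dir A j| ≤ 1 := by
        intro j hj
        rw [habs, if_neg]
        · split_ifs
          · exact hη1
          · exact le_rfl
        · rintro rfl
          exact Finset.mem_compl.mp hj hτA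
      calc ∑ j ∈ Mᶜ, |dir A j| ≤ ∑ j ∈ Mᶜ, (1 : ℝ) := Finset.sum_le_sum hle
        _ = ((Mᶜ).card : ℝ) := by simp
        _ < ((m + 3 : ℕ) : ℝ) := by
          have h1 : Mᶜ.card < m + 3 := by
            have := Finset.card_compl_lt_iff_nonempty M |>.mpr ⟨_, hτA⟩
            simpa using this
          exact_mod_cast h1
        _ = |dir A (τ A)| := by rw [habs, if_pos rfl]
end

section
/- For every n ≥ 3 there exists a set D ⊆ ℝⁿ \ {0} with cardinality |D| = 2^{n−1} such that for every 1-symmetric convex body B in ℝⁿ, the set D ∪ (−D) illuminates B; in particular, for every boundary point x of B there exist d ∈ D and a real number t ≠ 0 with x + t·d in the interior of B. Consequently, the X-ray number of every 1-symmetric convex body in ℝⁿ is at most 2^{n−1}. -/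
/-- There is an antipodally symmetric choice of a coordinate for every sign pattern (the first
coordinate after which the sign changes) such that every sign pattern on a nonempty set `S` of
coordinates extends to a full one whose chosen coordinate lies in `S`. -/
theorem exists_pivot (k : ℕ) : ∃ piv : (Fin (k + 1) → Bool) → Fin (k + 1),
    (∀ ε, piv (fun i => !ε i) = piv ε) ∧
    ∀ S : Set (Fin (k + 1)), S.Nonempty → ∀ σ : Fin (k + 1) → Bool,
      ∃ ε, (∀ i ∈ S, ε i = σ i) ∧ piv ε ∈ S := by
  induction k with
  | zero =>
    refine ⟨fun _ => 0, fun _ => rfl, fun S hS σ => ⟨σ, fun _ _ => rfl, ?_⟩⟩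
    obtain ⟨i, hi⟩ := hS
    rwa [Fin.fin_one_eq_zero i] at hi
  | succ k ih =>
    obtain ⟨piv, hneg, hext⟩ := ih
    refine ⟨fun ε => if ε 0 ≠ ε 1 then 0 else (piv (fun i => ε i.succ)).succ, ?_, ?_⟩
    · intro ε
      simp [hneg (fun i => ε i.succ)]
    · intro S hS σ
      by_cases h0 : (0 : Fin (k + 2)) ∈ S ∧ ((1 : Fin (k + 2)) ∈ S → σ 1 ≠ σ 0)
      · refine ⟨Function.update σ 1 (!σ 0), fun i hi => ?_, ?_⟩
        · by_cases h1 : i = 1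
          · subst h1
            have := h0.2 hi
            simp only [Function.update_self]
            cases h : σ 0 <;> cases h' : σ 1 <;> simp_all
          · simp [h1]
        · simp [Function.update, h0.1]
      · have hS' : (Fin.succ ⁻¹' S).Nonempty := by
          by_cases h00 : (0 : Fin (k + 2)) ∈ S
          · exact ⟨0, by simpa using (Classical.not_imp.1 fun h => h0 ⟨h00, h⟩).1⟩
          · obtain ⟨i, hi⟩ := hS
            refine ⟨i.pred fun h => h00 (h ▸ hi), by simpa using hi⟩
        obtain ⟨ε, hε, hp⟩ := hext _ hS' (fun i => σ i.succ)
        refine ⟨Fin.cons (ε 0) ε, fun i hi => ?_, ?_⟩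
        · refine Fin.cases (fun hi => ?_) (fun j hj => ?_) i hi
          · have h1 := Classical.not_imp.1 fun h => h0 ⟨hi, h⟩
            have h2 := hε 0 (by simpa using h1.1)
            simpa [h2] using h1.2
          · simpa using hε j hj
        · have h1 : (Fin.cons (ε 0) ε : Fin (k + 2) → Bool) 1 = ε 0 := rfl
          simpa [h1] using hp

/-- A convex set invariant under sign changes of the coordinates is solid. -/
theorem mem_of_abs_le_of_unconditional {ι : Type*} [Fintype ι] {B : Set (ι → ℝ)}
    (hB : Convex ℝ B)
    (hsign : ∀ x ∈ B, ∀ ε : ι → ℝ, (∀ i, ε i = 1 ∨ ε i = -1) → (fun i => ε i * x i) ∈ B)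
    {w z : ι → ℝ} (hw : w ∈ B) (hz : ∀ i, |z i| ≤ |w i|) : z ∈ B := by
  classical
  suffices h : ∀ s : Finset ι, (fun i => if i ∈ s then z i else w i) ∈ B by
    simpa using h Finset.univ
  intro s
  induction s using Finset.induction_on with
  | empty => simpa using hw
  | insert a s ha ih =>
    set v : ι → ℝ := fun i => if i ∈ s then z i else w i with hv
    have hflip := hsign v ih (fun i => if i = a then -1 else 1) (fun i => by
      by_cases h : i = a <;> simp [h])
    obtain ⟨c, hc, hcz⟩ : ∃ c : ℝ, |c| ≤ 1 ∧ z a = c * w a := by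
      rcases eq_or_ne (w a) 0 with h | h
      · exact ⟨0, by simp, by simpa [h] using hz a⟩
      · exact ⟨z a / w a, by rw [abs_div]; exact div_le_one_of_le₀ (hz a) (abs_nonneg _),
          by field_simp⟩
    have hc' := abs_le.1 hc
    convert hB ih hflip (a := (1 + c) / 2) (b := (1 - c) / 2) (by linarith) (by linarith)
      (by ring) using 1
    ext i
    by_cases h : i = a
    · subst h
      simp only [Finset.mem_insert_self, if_true, hcz, hv, ha, if_false, Pi.add_apply,
        Pi.smul_apply, smul_eq_mul]
      ring
    · simp only [Finset.mem_insert, h, false_or, hv, if_false, Pi.add_apply, Pi.smul_apply,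
        smul_eq_mul]
      ring

/-- A set which is convex, symmetric about the origin and has nonempty interior is a neighbourhood
of the origin. -/
theorem zero_mem_interior_of_neg_mem {E : Type*} [NormedAddCommGroup E] [NormedSpace ℝ E]
    {B : Set E} (hB : Convex ℝ B) (hneg : ∀ x ∈ B, -x ∈ B) (hint : (interior B).Nonempty) :
    (0 : E) ∈ interior B := by
  obtain ⟨p, hp⟩ := hint
  obtain ⟨r, hr, hball⟩ := Metric.mem_nhds_iff.1 (mem_interior_iff_mem_nhds.1 hp)
  refine mem_interior_iff_mem_nhds.2 (Metric.mem_nhds_iff.2 ⟨r, hr, fun v hv => ?_⟩)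
  have hv' : ‖v‖ < r := by simpa using hv
  have h1 : p + v ∈ B := hball (by simpa using hv')
  have h2 : -(p - v) ∈ B := hneg _ (hball (by simpa using hv'))
  convert hB h1 h2 (a := 1 / 2) (b := 1 / 2) (by norm_num) (by norm_num) (by norm_num) using 1
  module

theorem abs_sub_mul_eq {x d t : ℝ} (hxd : 0 < d * x) (htx : t * |d| ≤ |x|) :
    |x - t * d| = |x| - t * |d| := by
  rcases pos_and_pos_or_neg_and_neg_of_mul_pos hxd with ⟨hd, hx⟩ | ⟨hd, hx⟩
  · rw [abs_of_pos hd, abs_of_pos hx] at *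
    exact abs_of_nonneg (by linarith)
  · rw [abs_of_neg hd, abs_of_neg hx] at *
    rw [abs_of_nonpos (by linarith)]
    ring

/-- In a convex set invariant under permutations, mass of a nonzero coordinate `i` of a point can
be spread evenly over the vanishing coordinates. -/
theorem exists_mem_spread {n : ℕ} {B : Set (Fin n → ℝ)} (hB : Convex ℝ B)
    (hperm : ∀ x ∈ B, ∀ σ : Equiv.Perm (Fin n), (fun i => x (σ i)) ∈ B)
    {x : Fin n → ℝ} (hx : x ∈ B) {i : Fin n} (hi : x i ≠ 0) {a : ℝ} (ha : 0 ≤ a) (ha1 : a ≤ 1) :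
    ∃ w ∈ B, (1 - a) * |x i| ≤ |w i| ∧ ∀ j, j ≠ i →
      (x j ≠ 0 → w j = x j) ∧ (x j = 0 → w j = a * (x i / n)) := by
  have hn : (0 : ℝ) < n := by exact_mod_cast i.pos
  let p : Fin n → Fin n → ℝ := fun j => if x j = 0 then fun k => x (Equiv.swap i j k) else x
  have hp : ∀ j, p j ∈ B := fun j => by
    by_cases h : x j = 0
    · simpa only [p, h, if_true] using hperm x hx _
    · simpa only [p, h, if_false] using hx
  have hu : (∑ j, (1 / n : ℝ) • p j) ∈ B :=
    hB.sum_mem (fun _ _ => by positivity) (by simp [hn.ne']) (fun j _ => hp j)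
  refine ⟨_, hB hx hu (a := 1 - a) (b := a) (by linarith) ha (by ring), ?_, fun j hj => ⟨?_, ?_⟩⟩
  · have h1 : ∀ j, p j i = (if x j = 0 then 0 else 1) * x i := fun j => by
      by_cases h : x j = 0 <;> simp [p, h]
    have h2 : (0 : ℝ) ≤ ∑ j, if x j = 0 then 0 else 1 :=
      Finset.sum_nonneg fun j _ => by split_ifs <;> norm_num
    simp only [Pi.add_apply, Pi.smul_apply, Finset.sum_apply, smul_eq_mul, h1]
    rw [← Finset.mul_sum, ← Finset.sum_mul]
    set r : ℝ := ∑ j, if x j = 0 then 0 else 1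
    rw [show (1 - a) * x i + a * (1 / n * (r * x i)) = ((1 - a) + a * (1 / n * r)) * x i by ring,
      abs_mul]
    have h3 : 0 ≤ a * (1 / n * r) := by positivity
    rw [abs_of_nonneg (by linarith : 0 ≤ (1 - a) + a * (1 / n * r))]
    gcongr
    linarith
  · intro hxj
    have h1 : ∀ k, p k j = x j := fun k => by
      by_cases h : x k = 0
      · have hjk : j ≠ k := fun h' => hxj (h' ▸ h)
        simp [p, h, Equiv.swap_apply_of_ne_of_ne hj hjk]
      · simp [p, h]
    simp only [Pi.add_apply, Pi.smul_apply, Finset.sum_apply, smul_eq_mul, h1]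
    simp only [Finset.sum_const, Finset.card_univ, Fintype.card_fin, nsmul_eq_mul]
    field_simp
    ring
  · intro hxj
    have h1 : ∀ k, p k j = if j = k then x i else 0 := fun k => by
      by_cases hjk : j = k
      · subst hjk
        simp [p, hxj]
      · by_cases h : x k = 0
        · simp [p, h, hjk, Equiv.swap_apply_of_ne_of_ne hj hjk, hxj]
        · simp [p, h, hjk, hxj]
    simp only [Pi.add_apply, Pi.smul_apply, Finset.sum_apply, smul_eq_mul, h1, hxj, mul_ite,
      mul_zero, Finset.sum_ite_eq, Finset.mem_univ, if_true]
    ring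

/-- If `d` has the same signs as `x` on the support of `x`, and one coordinate of `d` in this
support dominates all the others, then `-d` illuminates `x`. -/
theorem exists_sub_smul_mem_interior {n : ℕ} {B : Set (Fin n → ℝ)} (hB : Convex ℝ B)
    (hsymm : ∀ x ∈ B, ∀ σ : Equiv.Perm (Fin n), ∀ ε : Fin n → ℝ,
      (∀ i, ε i = 1 ∨ ε i = -1) → (fun i => ε i * x (σ i)) ∈ B)
    {x d : Fin n → ℝ} (hx : x ∈ B) {i : Fin n} {δ : ℝ} (hδ : 0 < δ) (hδn : (2 * n + 1) * δ ≤ 1)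
    (hi : x i ≠ 0) (hdi : |d i| = 1) (hd : ∀ j, j ≠ i → |d j| = δ)
    (hxd : ∀ j, x j ≠ 0 → 0 < d j * x j) :
    ∃ t : ℝ, 0 < t ∧ x - t • d ∈ interior B := by
  have hn : (0 : ℝ) < n := by exact_mod_cast i.pos
  obtain ⟨t, htx, ht⟩ : ∃ t : ℝ, (∀ j, x j ≠ 0 → t ≤ |x j|) ∧ 0 < t := by
    have h : ∀ᶠ t : ℝ in nhdsWithin 0 (Set.Ioi 0), ∀ j, x j ≠ 0 → t ≤ |x j| := by
      refine Filter.eventually_all.2 fun j => ?_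
      by_cases hj : x j = 0
      · simp [hj]
      · filter_upwards [nhdsWithin_le_nhds (Iic_mem_nhds (abs_pos.2 hj))] with t ht _ using ht
    exact (h.and self_mem_nhdsWithin).exists
  refine ⟨t, ht, mem_interior_iff_mem_nhds.2 (Filter.mem_of_superset
    (Metric.closedBall_mem_nhds _ (mul_pos ht hδ)) fun z hz => ?_)⟩
  have hδ1 : δ ≤ 1 := by nlinarith
  have hz' : ∀ j, |z j| ≤ |x j - t * d j| + t * δ := fun j => by
    have h1 : |z j - (x j - t * d j)| ≤ t * δ :=
      (dist_le_pi_dist z (x - t • d) j).trans hz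
    calc |z j| = |(x j - t * d j) + (z j - (x j - t * d j))| := by ring_nf
      _ ≤ _ := (abs_add_le _ _).trans (by linarith)
  have hxi : 0 < |x i| := abs_pos.2 hi
  have hti := htx i hi
  have htn : 2 * n * δ * t ≤ t - t * δ := by nlinarith
  have htδ : 0 < t * δ := mul_pos ht hδ
  obtain ⟨w, hw, hwi, hwj⟩ := exists_mem_spread hB
    (fun x hx σ => by simpa using hsymm x hx σ (fun _ => 1) (fun _ => Or.inl rfl)) hx hi
    (a := 2 * n * δ * t / |x i|) (by positivity)
    (div_le_one_of_le₀ (by linarith) (abs_nonneg _))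
  refine mem_of_abs_le_of_unconditional hB
    (fun x hx ε hε => by simpa using hsymm x hx 1 ε hε) hw fun j => ?_
  rcases eq_or_ne j i with rfl | hj
  · refine le_trans ?_ hwi
    have h1 := hz' j
    rw [abs_sub_mul_eq (hxd j hi) (by rw [hdi]; linarith), hdi] at h1
    have h2 : (1 - 2 * n * δ * t / |x j|) * |x j| = |x j| - 2 * n * δ * t := by
      field_simp
    linarith
  · have h1 := hz' j
    by_cases hxj : x j = 0
    · rw [(hwj j hj).2 hxj, abs_mul, abs_div, abs_div, abs_abs, Nat.abs_cast,
        abs_of_pos (by positivity : 0 < 2 * n * δ * t)]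
      rw [hxj, zero_sub, abs_neg, abs_mul, hd j hj, abs_of_pos ht] at h1
      have h2 : 2 * n * δ * t / |x i| * (|x i| / n) = 2 * δ * t := by
        field_simp
      linarith
    · rw [(hwj j hj).1 hxj]
      have := htx j hxj
      rw [abs_sub_mul_eq (hxd j hxj) (by rw [hd j hj]; nlinarith), hd j hj] at h1
      linarith

/-- Theorem: for every `n ≥ 3` there is a set `D` of `2^(n-1)` nonzero directions such that
`D ∪ (-D)` illuminates every 1-symmetric convex body in `ℝⁿ`: every boundary point `x` of
such a body satisfies `x + t • d ∈ int B` for some `d ∈ D` and `t ≠ 0`. In particular, the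
X-ray number of every 1-symmetric convex body in `ℝⁿ` is at most `2^(n-1)`. -/
theorem stmt_16 {n : ℕ} (hn : 3 ≤ n) :
    ∃ D : Finset (Fin n → ℝ),
      (∀ d ∈ D, d ≠ 0) ∧ D.card = 2 ^ (n - 1) ∧
      ∀ B : Set (Fin n → ℝ), Convex ℝ B → IsCompact B → (interior B).Nonempty →
        (∀ x ∈ B, ∀ σ : Equiv.Perm (Fin n), ∀ ε : Fin n → ℝ,
          (∀ i, ε i = 1 ∨ ε i = -1) → (fun i => ε i * x (σ i)) ∈ B) →
        ∀ x ∈ frontier B, ∃ d ∈ D, ∃ t : ℝ, t ≠ 0 ∧ x + t • d ∈ interior B := by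
  classical
  obtain ⟨k, rfl⟩ : ∃ k, n = k + 1 := ⟨n - 1, by omega⟩
  obtain ⟨piv, hneg, hext⟩ := exists_pivot k
  set δ : ℝ := 1 / (2 * (k + 1 : ℕ) + 1) with hδ
  have hδ0 : 0 < δ := by positivity
  let dir : (Fin (k + 1) → Bool) → Fin (k + 1) → ℝ := fun ε i =>
    (if ε i then 1 else -1) * (if i = piv ε then 1 else δ)
  have hdir : ∀ ε i, 0 < dir ε i ↔ ε i = true := fun ε i => by
    have : 0 < (if i = piv ε then 1 else δ) := by split_ifs <;> linarith
    cases h : ε i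
    · simpa only [dir, h, Bool.false_eq_true, if_false, iff_false, not_lt, neg_one_mul,
        neg_nonpos] using this.le
    · simpa [dir, h] using this
  have hdir_neg : ∀ ε, dir (fun i => !ε i) = -dir ε := fun ε => by
    ext i
    cases h : ε i <;> simp [dir, h, hneg, -mul_ite]
  have habs : ∀ ε i, |dir ε i| = if i = piv ε then 1 else δ := fun ε i => by
    have : 0 < (if i = piv ε then 1 else δ) := by split_ifs <;> linarith
    cases h : ε i <;> simp only [dir, h, abs_mul, abs_of_pos this] <;> simp
  have hinj : Function.Injective dir := fun ε ε' h => by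
    ext i
    rw [Bool.eq_iff_iff, ← hdir, ← hdir, h]
  have hinj' : Function.Injective fun ε : Fin k → Bool => dir (Fin.cons true ε) :=
    hinj.comp (Fin.cons_right_injective _)
  have hmem : ∀ ε : Fin (k + 1) → Bool, ε 0 = true →
      dir ε ∈ Finset.univ.image fun ε : Fin k → Bool => dir (Fin.cons true ε) := fun ε h =>
    Finset.mem_image.2 ⟨Fin.tail ε, Finset.mem_univ _, by
      show dir (Fin.cons true (Fin.tail ε)) = dir ε
      rw [← h, Fin.cons_self_tail]⟩
  refine ⟨Finset.univ.image fun ε : Fin k → Bool => dir (Fin.cons true ε), ?_, ?_, ?_⟩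
  · simp only [Finset.mem_image, Finset.mem_univ, true_and, forall_exists_index,
      forall_apply_eq_imp_iff]
    intro ε h
    have := (hdir (Fin.cons true ε) 0).2 rfl
    simp [h] at this
  · rw [Finset.card_image_of_injective _ hinj']
    simp
  · intro B hB hcomp hint hsymm x hx
    have h0 : (0 : Fin (k + 1) → ℝ) ∈ interior B := zero_mem_interior_of_neg_mem hB
      (fun y hy => by simpa using! hsymm y hy 1 (fun _ => -1) (fun _ => Or.inr rfl)) hint
    have hx0 : x ≠ 0 := fun h => hx.2 (h ▸ h0)
    obtain ⟨ε, hε, hp⟩ := hext {i | x i ≠ 0} (Function.ne_iff.1 hx0) (fun i => decide (0 < x i))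
    obtain ⟨t, ht, hmem_int⟩ := exists_sub_smul_mem_interior hB hsymm
      (hcomp.isClosed.frontier_subset hx) (d := dir ε) (i := piv ε) hδ0
      (by rw [hδ]; field_simp; rfl) hp (by simp [habs]) (fun j hj => by simp [habs, hj])
      (fun j hj => by
        have h1 : dir ε j ≠ 0 := fun h => by
          have := habs ε j
          rw [h, abs_zero] at this
          split_ifs at this <;> linarith
        have h2 : 0 < dir ε j ↔ 0 < x j := by rw [hdir, hε j hj, decide_eq_true_iff]
        rcases lt_or_gt_of_ne hj with h | h
        · exact mul_pos_of_neg_of_neg (lt_of_le_of_ne (not_lt.1 fun h' => h.not_gt (h2.1 h')) h1) h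
        · exact mul_pos (h2.2 h) h)
    cases h : ε 0
    · refine ⟨_, hmem (fun i => !ε i) (by simp [h]), t, ht.ne', ?_⟩
      rwa [hdir_neg, smul_neg, ← sub_eq_add_neg]
    · refine ⟨_, hmem ε h, -t, neg_ne_zero.2 ht.ne', ?_⟩
      rwa [neg_smul, ← sub_eq_add_neg]
end
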